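/- Let p ≥ 2, α = p−1 and θ ≥ 0. For every q ≥ p and every μ with 0 < μ < μ_{α,θ} there exists a constant c = c(μ,α,θ,q) > 0 such that for all u ∈ X with ‖u′‖_{L^p_α} ≤ 1 and ‖u‖_{L^p_θ} = 1 one has ∫₀^∞ e^{μ|u|^{p/(p−1)}} |u|^q dλ_θ ≤ c. -/

import Mathlib

open MeasureTheory Real Filter ENNReal

/-- The fractional-dimension spherical volume constant `ω_θ = 2π^((θ+1)/2)/Γ((θ+1)/2)`. -/
noncomputable def omegaW (θ : ℝ) : ℝ := 2 * Real.pi ^ ((θ + 1) / 2) / Real.Gamma ((θ + 1) / 2)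

/-- Weighted integral `∫₀^∞ f dλ_θ = ω_θ ∫₀^∞ f(r) r^θ dr` (for nonnegative integrands,
valued in `ℝ≥0∞`). -/
noncomputable def wInt (θ : ℝ) (f : ℝ → ℝ) : ℝ≥0∞ :=
  ENNReal.ofReal (omegaW θ) *
    ∫⁻ r in Set.Ioi (0 : ℝ), ENNReal.ofReal (f r) * ENNReal.ofReal (r ^ θ)

/-- The weighted Lebesgue norm `‖u‖_{L^q_θ}` (valued in `ℝ≥0∞`). -/
noncomputable def wNorm (θ q : ℝ) (u : ℝ → ℝ) : ℝ≥0∞ :=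
  (wInt θ fun r => |u r| ^ q) ^ (1 / q)

/-- Membership in the weighted Sobolev space `X = X^{1,p}_∞(α,θ)`:
`u` is locally absolutely continuous on `(0,∞)` with a.e. derivative `u'`
(expressed through the fundamental theorem of calculus on compact subintervals),
`u(r) → 0` as `r → ∞`, `‖u‖_{L^p_θ} < ∞` and `‖u'‖_{L^p_α} < ∞`. -/
structure MemX (p α θ : ℝ) (u u' : ℝ → ℝ) : Prop where
  ftc_int : ∀ a b : ℝ, 0 < a → a ≤ b → IntervalIntegrable u' MeasureTheory.volume a b
  ftc : ∀ a b : ℝ, 0 < a → a ≤ b → u b - u a = ∫ t in a..b, u' t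
  lim_zero : Filter.Tendsto u Filter.atTop (nhds 0)
  fin_u : wNorm θ p u < ⊤
  fin_u' : wNorm α p u' < ⊤

/-- Full norm on `X`: `‖u‖ = (‖u‖_{L^p_θ}^p + ‖u'‖_{L^p_α}^p)^{1/p}`. -/
noncomputable def Xnorm (p α θ : ℝ) (u u' : ℝ → ℝ) : ℝ≥0∞ :=
  ((wNorm θ p u) ^ p + (wNorm α p u') ^ p) ^ (1 / p)

/-- The truncated exponential `φ_p(t) = Σ_{j ∈ ℕ, j ≥ p-1} t^j / j!`. -/
noncomputable def phiP (p t : ℝ) : ℝ :=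
  ∑' j : ℕ, if p - 1 ≤ (j : ℝ) then t ^ j / (Nat.factorial j : ℝ) else 0

/-- The critical constant `μ_{α,θ} = (θ+1) ω_α^{1/α}`. -/
noncomputable def muC (α θ : ℝ) : ℝ := (θ + 1) * (omegaW α) ^ (1 / α)

/-- The Trudinger–Moser functional `∫₀^∞ φ_p(μ |u|^{p/(p-1)}) dλ_θ`. -/
noncomputable def TMfunc (p θ μ : ℝ) (u : ℝ → ℝ) : ℝ≥0∞ :=
  wInt θ fun r => phiP p (μ * |u r| ^ (p / (p - 1)))

/-- The subcritical Trudinger–Moser supremum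
`TMSC(μ,α,θ) = sup { ‖u‖_{L^p_θ}^{-p} ∫₀^∞ φ_p(μ|u|^{p/(p-1)}) dλ_θ : u ∈ X, u ≠ 0, ‖u'‖_{L^p_α} ≤ 1 }`. -/
noncomputable def TMSC (p α θ μ : ℝ) : ℝ≥0∞ :=
  ⨆ (u : ℝ → ℝ) (u' : ℝ → ℝ) (_ : MemX p α θ u u') (_ : u ≠ 0)
    (_ : wNorm α p u' ≤ 1), (wNorm θ p u) ^ (-p) * TMfunc p θ μ u

/-- The critical Trudinger–Moser supremum
`TMC(σ,α,θ) = sup { ∫₀^∞ φ_p(σ|u|^{p/(p-1)}) dλ_θ : u ∈ X, ‖u‖ ≤ 1 }`. -/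
noncomputable def TMC (p α θ σ : ℝ) : ℝ≥0∞ :=
  ⨆ (u : ℝ → ℝ) (u' : ℝ → ℝ) (_ : MemX p α θ u u') (_ : Xnorm p α θ u u' ≤ 1),
    TMfunc p θ σ u

/-- `k₀ = min { j ∈ ℕ : j ≥ p - 1 }`. -/
noncomputable def k0 (p : ℝ) : ℕ := sInf {j : ℕ | p - 1 ≤ (j : ℝ)}

/-- `TMC(σ,α,θ)` is attained by some `u ∈ X` with `‖u‖ ≤ 1`. -/
def TMCAttained (p α θ σ : ℝ) : Prop :=
  ∃ u u' : ℝ → ℝ, MemX p α θ u u' ∧ Xnorm p α θ u u' ≤ 1 ∧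
    TMC p α θ σ = TMfunc p θ σ u

/-- `σ_* = inf { σ ∈ (0, μ_{α,θ}) : TMC(σ,α,θ) is attained }`. -/
noncomputable def sigmaStar (p α θ : ℝ) : ℝ :=
  sInf {σ : ℝ | σ ∈ Set.Ioo 0 (muC α θ) ∧ TMCAttained p α θ σ}

theorem omegaW_pos {θ : ℝ} (hθ : 0 ≤ θ) : 0 < omegaW θ := by
  unfold omegaW
  have := Real.Gamma_pos_of_pos (s := (θ + 1) / 2) (by linarith)
  have := Real.pi_pos
  positivity

theorem wInt_rpow_le_one {θ p : ℝ} (hp : 0 < p) {v : ℝ → ℝ} (h : wNorm θ p v ≤ 1) :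
    wInt θ (fun r => |v r| ^ p) ≤ 1 := by
  unfold wNorm at h
  by_contra hc
  exact absurd h (not_le.2 (ENNReal.one_lt_rpow (not_le.1 hc) (by positivity)))

theorem lintegral_Ioc_inv {a b : ℝ} (ha : 0 < a) (hab : a ≤ b) :
    ∫⁻ t in Set.Ioc a b, ENNReal.ofReal t⁻¹ = ENNReal.ofReal (Real.log (b / a)) := by
  have hb : 0 < b := ha.trans_le hab
  rw [← integral_inv_of_pos ha hb, intervalIntegral.integral_of_le hab,
    ofReal_integral_eq_lintegral_ofReal]
  · have : IntervalIntegrable (fun t : ℝ => t⁻¹) volume a b := by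
      rw [intervalIntegrable_inv_iff]
      right
      rw [Set.uIcc_of_le hab]
      exact fun h => absurd h.1 (not_le.2 ha)
    exact (intervalIntegrable_iff_integrableOn_Ioc_of_le hab).1 this
  · filter_upwards [ae_restrict_mem measurableSet_Ioc] with t ht
    exact inv_nonneg.2 (ha.trans ht.1).le

/-- Hölder's inequality against the weight `t ^ (p - 1)`: increments of `u` over `[a, b]` are
controlled by a power of `log (b / a)`. -/
theorem MemX.abs_sub_le {p θ : ℝ} (hp : 2 ≤ p) {u u' : ℝ → ℝ} (h : MemX p (p - 1) θ u u')
    (h1 : wNorm (p - 1) p u' ≤ 1) {a b : ℝ} (ha : 0 < a) (hab : a ≤ b) :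
    |u b - u a| ≤ (omegaW (p - 1))⁻¹ ^ (1 / p) * Real.log (b / a) ^ ((p - 1) / p) := by
  have hp0 : 0 < p := by linarith
  have hω : 0 < omegaW (p - 1) := omegaW_pos (by linarith)
  have hpq : p.HolderConjugate (p / (p - 1)) :=
    Real.HolderConjugate.conjExponent (by linarith : (1 : ℝ) < p)
  have hu_int := (intervalIntegrable_iff_integrableOn_Ioc_of_le hab).1 (h.ftc_int a b ha hab)
  have hlog : 0 ≤ Real.log (b / a) := Real.log_nonneg ((one_le_div ha).2 hab)
  have hA : ∫⁻ t in Set.Ioc a b, ENNReal.ofReal (|u' t| ^ p) * ENNReal.ofReal (t ^ (p - 1)) ≤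
      ENNReal.ofReal (omegaW (p - 1))⁻¹ := by
    have h2 := wInt_rpow_le_one hp0 h1
    unfold wInt at h2
    rw [ENNReal.ofReal_inv_of_pos hω]
    refine (lintegral_mono_set (fun t ht => ha.trans ht.1)).trans ?_
    rw [ENNReal.le_inv_iff_mul_le, mul_comm]
    exact h2
  have key : ‖u b - u a‖ₑ ≤ ENNReal.ofReal (omegaW (p - 1))⁻¹ ^ (1 / p) *
      ENNReal.ofReal (Real.log (b / a)) ^ (1 / (p / (p - 1))) := by
    rw [h.ftc a b ha hab, intervalIntegral.integral_of_le hab]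
    refine (enorm_integral_le_lintegral_enorm _).trans ?_
    have hsplit : ∫⁻ t in Set.Ioc a b, ‖u' t‖ₑ = ∫⁻ t in Set.Ioc a b,
        ((fun t => ‖u' t‖ₑ * ENNReal.ofReal (t ^ ((p - 1) / p))) *
          (fun t => ENNReal.ofReal (t ^ (-((p - 1) / p))))) t := by
      refine setLIntegral_congr_fun measurableSet_Ioc fun t ht => ?_
      have ht0 : 0 < t := ha.trans ht.1
      simp only [Pi.mul_apply]
      rw [mul_assoc, ← ENNReal.ofReal_mul (by positivity), ← Real.rpow_add ht0]
      simp
    rw [hsplit]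
    refine (ENNReal.lintegral_mul_le_Lp_mul_Lq _ hpq
      (hu_int.aestronglyMeasurable.enorm.mul (by fun_prop)) (by fun_prop)).trans ?_
    gcongr
    · refine le_trans (le_of_eq ?_) hA
      refine setLIntegral_congr_fun measurableSet_Ioc fun t ht => ?_
      have ht0 : 0 < t := ha.trans ht.1
      rw [Pi.mul_apply, ENNReal.mul_rpow_of_nonneg _ _ hp0.le, Real.enorm_eq_ofReal_abs,
        ENNReal.ofReal_rpow_of_nonneg (abs_nonneg _) hp0.le,
        ENNReal.ofReal_rpow_of_nonneg (by positivity) hp0.le, ← Real.rpow_mul ht0.le]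
      congr 3
      field_simp
    · exact hpq.symm.one_div_nonneg
    · rw [← lintegral_Ioc_inv ha hab]
      refine le_of_eq (setLIntegral_congr_fun measurableSet_Ioc fun t ht => ?_)
      have ht0 : 0 < t := ha.trans ht.1
      have hp1 : p - 1 ≠ 0 := by linarith
      rw [ENNReal.ofReal_rpow_of_nonneg (by positivity) hpq.symm.nonneg, ← Real.rpow_mul ht0.le,
        ← Real.rpow_neg_one]
      congr 2
      field_simp
  rw [one_div_div, Real.enorm_eq_ofReal_abs,
    ENNReal.ofReal_rpow_of_nonneg (by positivity) (by positivity),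
    ENNReal.ofReal_rpow_of_nonneg hlog (div_nonneg (by linarith) hp0.le),
    ← ENNReal.ofReal_mul (by positivity)] at key
  exact (ENNReal.ofReal_le_ofReal_iff (by positivity)).1 key

theorem exists_abs_le_of_wNorm_le_one {p θ : ℝ} (hp : 0 < p) (hθ : 0 ≤ θ) {u : ℝ → ℝ}
    (h : wNorm θ p u ≤ 1) {r : ℝ} (hr : 1 ≤ r) :
    ∃ s ∈ Set.Ioc r (r + 1), |u s| ≤ (2 / omegaW θ) ^ (1 / p) := by
  have hω := omegaW_pos hθ
  by_contra! hc
  have h2 := wInt_rpow_le_one hp h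
  have h3 : ENNReal.ofReal (2 / omegaW θ) ≤
      ∫⁻ t in Set.Ioi (0 : ℝ), ENNReal.ofReal (|u t| ^ p) * ENNReal.ofReal (t ^ θ) := by
    have : ENNReal.ofReal (2 / omegaW θ) =
        ∫⁻ _ in Set.Ioc r (r + 1), ENNReal.ofReal (2 / omegaW θ) := by
      simp
    rw [this]
    refine le_trans (setLIntegral_mono' measurableSet_Ioc fun t ht => ?_)
      (lintegral_mono_set (fun t ht => (by linarith [ht.1] : (0 : ℝ) < t)))
    rw [← ENNReal.ofReal_mul (by positivity)]
    apply ENNReal.ofReal_le_ofReal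
    have e1 : 2 / omegaW θ ≤ |u t| ^ p := by
      have := Real.rpow_le_rpow (by positivity) (hc t ht).le hp.le
      rwa [← Real.rpow_mul (by positivity), one_div_mul_cancel hp.ne', Real.rpow_one] at this
    have e2 : 1 ≤ t ^ θ := Real.one_le_rpow (by linarith [ht.1]) hθ
    nlinarith [(by positivity : 0 ≤ |u t| ^ p)]
  have h4 : (2 : ℝ≥0∞) ≤ 1 := by
    refine le_trans (le_trans (le_of_eq ?_) (mul_le_mul_right h3 (ENNReal.ofReal (omegaW θ)))) h2
    rw [← ENNReal.ofReal_mul hω.le, mul_div_cancel₀ _ hω.ne']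
    simp
  exact absurd h4 (by norm_num)

theorem rpow_le_const_mul_exp {s δ t : ℝ} (hs : 0 < s) (hδ : 0 < δ) (ht : 0 ≤ t) :
    t ^ s ≤ (s / δ) ^ s * Real.exp (δ * t) := by
  have h1 : δ * t / s ≤ Real.exp (δ * t / s) := by linarith [Real.add_one_le_exp (δ * t / s)]
  calc t ^ s = (s / δ * (δ * t / s)) ^ s := by congr 1; field_simp
    _ = (s / δ) ^ s * (δ * t / s) ^ s := Real.mul_rpow (by positivity) (by positivity)
    _ ≤ (s / δ) ^ s * Real.exp (δ * t / s) ^ s := by gcongr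
    _ = (s / δ) ^ s * Real.exp (δ * t) := by
      rw [← Real.exp_mul]; congr 2; field_simp

/-- A function with logarithmic growth `K * L ^ (1 / m)`, up to an additive constant, has
`m`-exponential growth of any rate larger than `μ * K ^ m` in `L`. -/
theorem exists_exp_rpow_mul_rpow_le {m q μ K M γ : ℝ} (hm : 0 < m) (hq : 0 < q) (hμ : 0 < μ)
    (hK : 0 < K) (hM : 0 ≤ M) (hγ : μ * K ^ m < γ) :
    ∃ C β : ℝ, 0 ≤ C ∧ β < γ ∧ ∀ L x : ℝ, 0 ≤ L → 0 ≤ x → x ≤ M + K * L ^ (1 / m) →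
      Real.exp (μ * x ^ m) * x ^ q ≤ C * Real.exp (β * L) := by
  obtain ⟨ε, hε, hεγ⟩ : ∃ ε : ℝ, 0 < ε ∧ (μ + ε) * ((1 + ε) * K) ^ m < γ := by
    have hc : ContinuousAt (fun ε : ℝ => (μ + ε) * ((1 + ε) * K) ^ m) 0 :=
      (by fun_prop : ContinuousAt (fun ε : ℝ => μ + ε) 0).mul
        ((by fun_prop : ContinuousAt (fun ε : ℝ => (1 + ε) * K) 0).rpow_const (Or.inr hm.le))
    have he := hc.eventually_lt_const (u := γ) (by simpa using hγ)
    obtain ⟨ε, h1, h2⟩ := ((he.filter_mono nhdsWithin_le_nhds).and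
      (self_mem_nhdsWithin (a := (0 : ℝ)) (s := Set.Ioi 0))).exists
    exact ⟨ε, h2, h1⟩
  set B := M + M / ε
  have hB : 0 ≤ B := by positivity
  set D := (q / m / ε) ^ (q / m)
  have hD : 0 ≤ D := by positivity
  have hβ : 0 ≤ (μ + ε) * ((1 + ε) * K) ^ m := by positivity
  refine ⟨Real.exp (μ * B ^ m) * B ^ q + D, (μ + ε) * ((1 + ε) * K) ^ m, by positivity, hεγ,
    fun L x hL hx hxL => ?_⟩
  rw [add_mul]
  rcases le_total x B with hxB | hxB
  · have h1 : 1 ≤ Real.exp ((μ + ε) * ((1 + ε) * K) ^ m * L) := Real.one_le_exp (by positivity)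
    calc Real.exp (μ * x ^ m) * x ^ q ≤ Real.exp (μ * B ^ m) * B ^ q := by gcongr
      _ ≤ Real.exp (μ * B ^ m) * B ^ q * Real.exp ((μ + ε) * ((1 + ε) * K) ^ m * L) :=
        le_mul_of_one_le_right (by positivity) h1
      _ ≤ _ := le_add_of_nonneg_right (by positivity)
  · have hy : x ≤ (1 + ε) * K * L ^ (1 / m) := by
      have h1 : M / ε ≤ K * L ^ (1 / m) := by linarith
      rw [div_le_iff₀ hε] at h1
      nlinarith
    have hxm : x ^ m ≤ ((1 + ε) * K) ^ m * L := by
      have := Real.rpow_le_rpow hx hy hm.le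
      rwa [Real.mul_rpow (by positivity) (by positivity), ← Real.rpow_mul hL,
        one_div_mul_cancel hm.ne', Real.rpow_one] at this
    have hxq : x ^ q ≤ D * Real.exp (ε * x ^ m) := by
      have := rpow_le_const_mul_exp (s := q / m) (by positivity) hε (Real.rpow_nonneg hx m)
      rwa [← Real.rpow_mul hx, mul_div_cancel₀ _ hm.ne'] at this
    calc Real.exp (μ * x ^ m) * x ^ q ≤ Real.exp (μ * x ^ m) * (D * Real.exp (ε * x ^ m)) := by
          gcongr
      _ = D * Real.exp ((μ + ε) * x ^ m) := by rw [add_mul, Real.exp_add]; ring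
      _ ≤ D * Real.exp ((μ + ε) * (((1 + ε) * K) ^ m * L)) := by gcongr
      _ = D * Real.exp ((μ + ε) * ((1 + ε) * K) ^ m * L) := by rw [mul_assoc (μ + ε)]
      _ ≤ _ := le_add_of_nonneg_left (by positivity)

/-- The radial lemma: a uniform bound on `[1, ∞)`. -/
theorem MemX.abs_le_of_one_le {p θ : ℝ} (hp : 2 ≤ p) (hθ : 0 ≤ θ) {u u' : ℝ → ℝ}
    (h : MemX p (p - 1) θ u u') (h1 : wNorm (p - 1) p u' ≤ 1) (h2 : wNorm θ p u ≤ 1) {r : ℝ}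
    (hr : 1 ≤ r) : |u r| ≤ (2 / omegaW θ) ^ (1 / p) + (omegaW (p - 1))⁻¹ ^ (1 / p) := by
  obtain ⟨s, hs, hus⟩ := exists_abs_le_of_wNorm_le_one (by linarith) hθ h2 hr
  have hr0 : 0 < r := by linarith
  have hω : 0 < omegaW (p - 1) := omegaW_pos (by linarith)
  have h3 := h.abs_sub_le hp h1 hr0 hs.1.le
  have hsr : 1 ≤ s / r := (one_le_div hr0).2 hs.1.le
  have hlog : Real.log (s / r) ≤ 1 := by
    have : s / r ≤ 2 := (div_le_iff₀ hr0).2 (by linarith [hs.2])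
    linarith [Real.log_le_sub_one_of_pos (by linarith : 0 < s / r)]
  have hlog' : Real.log (s / r) ^ ((p - 1) / p) ≤ 1 :=
    Real.rpow_le_one (Real.log_nonneg hsr) hlog (div_nonneg (by linarith) (by linarith))
  have h4 := mul_le_of_le_one_right (a := (omegaW (p - 1))⁻¹ ^ (1 / p)) (by positivity) hlog'
  have h5 := abs_sub_abs_le_abs_sub (u r) (u s)
  rw [abs_sub_comm] at h5
  linarith

theorem lintegral_Ioc_rpow_lt_top {s : ℝ} (hs : -1 < s) :
    ∫⁻ r in Set.Ioc (0 : ℝ) 1, ENNReal.ofReal (r ^ s) < ⊤ :=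
  ((intervalIntegrable_iff_integrableOn_Ioc_of_le zero_le_one).1
    (intervalIntegral.intervalIntegrable_rpow' hs)).lintegral_lt_top

theorem stmt_15 (p α θ : ℝ) (hp : 2 ≤ p) (hα : α = p - 1) (hθ : 0 ≤ θ) :
    ∀ q : ℝ, p ≤ q → ∀ μ : ℝ, 0 < μ → μ < muC α θ →
      ∃ c : ℝ, 0 < c ∧ ∀ u u' : ℝ → ℝ, MemX p α θ u u' →
        wNorm α p u' ≤ 1 → wNorm θ p u = 1 →
        wInt θ (fun r => Real.exp (μ * |u r| ^ (p / (p - 1))) * |u r| ^ q) ≤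
          ENNReal.ofReal c := by
  subst hα
  intro q hq μ hμ hμc
  have hp0 : 0 < p := by linarith
  have hp1 : 0 < p - 1 := by linarith
  have hω := omegaW_pos hθ
  have hωα : 0 < omegaW (p - 1) := omegaW_pos hp1.le
  set K := (omegaW (p - 1))⁻¹ ^ (1 / p) with hK
  have hK0 : 0 < K := by positivity
  set M := (2 / omegaW θ) ^ (1 / p) + K with hM
  have hM0 : 0 ≤ M := by positivity
  set m := p / (p - 1) with hm
  have hm0 : 0 < m := by positivity
  have hγ : μ * K ^ m < θ + 1 := by
    have : K ^ m = (omegaW (p - 1) ^ (1 / (p - 1)))⁻¹ := by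
      rw [hK, ← Real.rpow_mul (by positivity), ← Real.inv_rpow hωα.le]
      congr 1
      rw [hm]
      field_simp
    rw [this, ← div_eq_mul_inv, div_lt_iff₀ (by positivity)]
    exact hμc
  obtain ⟨C, β, hC, hβ, hCβ⟩ :=
    exists_exp_rpow_mul_rpow_le (q := q) hm0 (by linarith) hμ hK0 hM0 hγ
  set E := Real.exp (μ * M ^ m) * M ^ (q - p)
  have hE : 0 ≤ E := by positivity
  set T : ℝ≥0∞ := ENNReal.ofReal (omegaW θ) *
    (ENNReal.ofReal C * ∫⁻ r in Set.Ioc (0 : ℝ) 1, ENNReal.ofReal (r ^ (θ - β))) +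
      ENNReal.ofReal E
  have hT : T ≠ ⊤ := by
    have := (lintegral_Ioc_rpow_lt_top (s := θ - β) (by linarith)).ne
    finiteness
  refine ⟨T.toReal + 1, by positivity, fun u u' h h1 h2 => ?_⟩
  refine le_trans ?_ (((ENNReal.ofReal_toReal hT).ge).trans
    (ENNReal.ofReal_le_ofReal (by linarith)))
  have hu : ∀ r, 1 ≤ r → |u r| ≤ M := fun r hr => h.abs_le_of_one_le hp hθ h1 h2.le hr
  have hu0 : ∀ r, 0 < r → r ≤ 1 → |u r| ≤ M + K * (-Real.log r) ^ (1 / m) := by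
    intro r hr hr1
    have h3 := h.abs_sub_le hp h1 hr hr1
    rw [one_div r, Real.log_inv, ← hK, ← one_div_div, ← hm] at h3
    have h5 := abs_sub_abs_le_abs_sub (u r) (u 1)
    rw [abs_sub_comm] at h5
    linarith [hu 1 le_rfl]
  unfold wInt
  rw [← Set.Ioc_union_Ioi_eq_Ioi (zero_le_one' ℝ),
    lintegral_union measurableSet_Ioi (Set.Ioc_disjoint_Ioi le_rfl), mul_add]
  refine add_le_add (mul_le_mul_right ?_ _) ?_
  · rw [← lintegral_const_mul' _ _ ENNReal.ofReal_ne_top]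
    refine setLIntegral_mono' measurableSet_Ioc fun r hr => ?_
    rw [← ENNReal.ofReal_mul (by positivity), ← ENNReal.ofReal_mul hC]
    apply ENNReal.ofReal_le_ofReal
    have h3 := hCβ (-Real.log r) |u r| (neg_nonneg.2 (Real.log_nonpos hr.1.le hr.2))
      (abs_nonneg _) (hu0 r hr.1 hr.2)
    have h4 : r ^ (θ - β) = Real.exp (β * -Real.log r) * r ^ θ := by
      rw [sub_eq_neg_add, Real.rpow_add hr.1, Real.rpow_def_of_pos hr.1 (-β)]
      congr 2
      ring
    rw [h4, ← mul_assoc]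
    exact mul_le_mul_of_nonneg_right h3 (Real.rpow_nonneg hr.1.le _)
  · have h3 := wInt_rpow_le_one hp0 h2.le
    have h4 : ∫⁻ r in Set.Ioi (1 : ℝ),
        ENNReal.ofReal (Real.exp (μ * |u r| ^ m) * |u r| ^ q) * ENNReal.ofReal (r ^ θ) ≤
        ENNReal.ofReal E *
          ∫⁻ r in Set.Ioi (0 : ℝ), ENNReal.ofReal (|u r| ^ p) * ENNReal.ofReal (r ^ θ) := by
      rw [← lintegral_const_mul' _ _ ENNReal.ofReal_ne_top]
      refine le_trans (setLIntegral_mono' measurableSet_Ioi fun r hr => ?_)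
        (lintegral_mono_set (Set.Ioi_subset_Ioi zero_le_one))
      rw [← mul_assoc, ← ENNReal.ofReal_mul hE]
      refine mul_le_mul_left (ENNReal.ofReal_le_ofReal ?_) _
      have h5 := hu r (le_of_lt hr)
      calc Real.exp (μ * |u r| ^ m) * |u r| ^ q
          = Real.exp (μ * |u r| ^ m) * |u r| ^ (q - p) * |u r| ^ p := by
            rw [mul_assoc, ← Real.rpow_add_of_nonneg (abs_nonneg _) (by linarith) hp0.le,
              sub_add_cancel]
        _ ≤ Real.exp (μ * M ^ m) * M ^ (q - p) * |u r| ^ p := by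
            have : 0 ≤ q - p := by linarith
            gcongr
    refine (mul_le_mul_right h4 _).trans ?_
    rw [mul_left_comm]
    exact mul_le_of_le_one_right' h3
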